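/- For α = 1 and n ≥ 5, the strong price of anarchy of the network creation game equals (3n+2)/(3n). In particular, the worst-case strong equilibrium social cost is 3n(n−1)/2 + (n−1) while the optimal social cost (complete graph) is 3n(n−1)/2. -/

import Mathlib

open SimpleGraph ENNReal Finset

/-- A strategy profile: each player chooses a set of other players. -/
abbrev Profile (n : ℕ) := Fin n → Finset (Fin n)

/-- Validity: no player buys an edge to herself. -/
def Valid {n : ℕ} (s : Profile n) : Prop := ∀ i, i ∉ s i

/-- The graph formed by a strategy profile: `{i,j}` is an edge iff `j ∈ s i` or `i ∈ s j`. -/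
def NCGraph {n : ℕ} (s : Profile n) : SimpleGraph (Fin n) :=
  SimpleGraph.fromRel (fun i j => j ∈ s i)

instance {n : ℕ} (s : Profile n) : DecidableRel (NCGraph s).Adj := fun i j =>
  decidable_of_iff (i ≠ j ∧ (j ∈ s i ∨ i ∈ s j))
    (SimpleGraph.fromRel_adj (fun a b => b ∈ s a) i j).symm

/-- Distance cost of player `i`: sum of (extended) distances to all players. -/
noncomputable def dCost {n : ℕ} (s : Profile n) (i : Fin n) : ℝ≥0∞ :=
  ∑ j, ((NCGraph s).edist i j : ℝ≥0∞)

/-- Total cost of player `i` in the network creation game with parameter `α`. -/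
noncomputable def cost {n : ℕ} (α : ℝ) (s : Profile n) (i : Fin n) : ℝ≥0∞ :=
  ENNReal.ofReal α * (s i).card + dCost s i

/-- Social cost: sum of all players' costs. -/
noncomputable def socialCost {n : ℕ} (α : ℝ) (s : Profile n) : ℝ≥0∞ :=
  ∑ i, cost α s i

/-- A profile is rational if no edge is bought by both of its endpoints. -/
def Rational {n : ℕ} (s : Profile n) : Prop := ∀ i j, j ∈ s i → i ∉ s j

/-- Pure Nash equilibrium. -/
def IsNashEq {n : ℕ} (α : ℝ) (s : Profile n) : Prop :=
  ∀ (i : Fin n) (t : Finset (Fin n)), i ∉ t →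
    cost α s i ≤ cost α (Function.update s i t) i

/-- Strong equilibrium: no nonempty coalition has a joint deviation strictly
decreasing every member's cost. -/
def IsStrongEq {n : ℕ} (α : ℝ) (s : Profile n) : Prop :=
  ∀ (K : Finset (Fin n)) (s' : Profile n), K.Nonempty → Valid s' →
    (∀ i ∉ K, s' i = s i) → ∃ i ∈ K, cost α s i ≤ cost α s' i

/-- A star graph: one center adjacent to all other vertices, and no other edges. -/
def IsStar {V : Type*} (G : SimpleGraph V) : Prop :=
  ∃ c : V, ∀ i j : V, G.Adj i j ↔ i ≠ j ∧ (i = c ∨ j = c)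

/-- `j` buys the edge to `i`, and `i` does not buy it. -/
def InE {n : ℕ} (s : Profile n) (i : Fin n) : Finset (Fin n) :=
  univ.filter (fun j => i ∈ s j ∧ j ∉ s i)

/-- Lower bound for the distance. -/
def dd {n : ℕ} (s : Profile n) (i j : Fin n) : ℕ :=
  if i = j then 0 else if (NCGraph s).Adj i j then 1 else 2

/-- Lower bound for the cost. -/
def lb {n : ℕ} (s : Profile n) (i : Fin n) : ℕ := (s i).card + ∑ j, dd s i j

def Diam2 {n : ℕ} (s : Profile n) : Prop :=
  ∀ i j, i ≠ j → (NCGraph s).Adj i j ∨ ∃ k, (NCGraph s).Adj i k ∧ (NCGraph s).Adj k j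

lemma nc_adj {n : ℕ} (s : Profile n) (i j : Fin n) :
    (NCGraph s).Adj i j ↔ i ≠ j ∧ (j ∈ s i ∨ i ∈ s j) := by
  unfold NCGraph; exact SimpleGraph.fromRel_adj _ _ _

lemma lb_add {n : ℕ} (s : Profile n) (hs : Valid s) (i : Fin n) :
    lb s i + (InE s i).card = 2 * (n - 1) := by
  have h1 : (s i).card = ∑ j, if j ∈ s i then 1 else 0 := by simp
  have h2 : (InE s i).card = ∑ j, if i ∈ s j ∧ j ∉ s i then 1 else 0 := by
    rw [InE, Finset.card_filter]
  have h3 : 2 * (n - 1) = ∑ j : Fin n, if j = i then 0 else 2 := by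
    have : ∀ j : Fin n, (if j = i then 0 else 2) = if j ≠ i then 2 else 0 := by
      intro j; split_ifs <;> simp_all
    simp only [this]
    rw [← Finset.sum_filter]
    simp [Finset.filter_ne', Finset.card_erase_of_mem]
    ring
  rw [lb, h1, h2, h3, ← Finset.sum_add_distrib, ← Finset.sum_add_distrib]
  refine Finset.sum_congr rfl fun j _ => ?_
  have := hs i
  unfold dd
  simp only [nc_adj]
  by_cases hij : i = j
  · subst hij; simp [this]
  · have h' : j ≠ i := fun h => hij h.symm
    by_cases ha : j ∈ s i <;> by_cases hb : i ∈ s j <;> simp [hij, h', ha, hb]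

lemma edist_lt_three {V : Type*} (G : SimpleGraph V) (i j : V) (h : G.edist i j < 3) :
    i = j ∨ G.Adj i j ∨ ∃ k, G.Adj i k ∧ G.Adj k j := by
  have hne : G.edist i j ≠ ⊤ := fun h' => by simp [h'] at h
  obtain ⟨p, hp⟩ := SimpleGraph.exists_walk_of_edist_ne_top hne
  rw [← hp] at h
  have hl : p.length < 3 := by exact_mod_cast h
  match p, hl with
  | .nil, _ => left; rfl
  | .cons h1 .nil, _ => right; left; exact h1
  | .cons h1 (.cons h2 .nil), _ => right; right; exact ⟨_, h1, h2⟩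
  | .cons h1 (.cons h2 (.cons h3 q)), hl => simp only [SimpleGraph.Walk.length_cons] at hl; omega

lemma dd_le {n : ℕ} (s : Profile n) (i j : Fin n) : (dd s i j : ℕ∞) ≤ (NCGraph s).edist i j := by
  unfold dd
  split_ifs with h1 h2
  · simp
  · have : (NCGraph s).edist i j ≠ 0 := by simpa using h1
    simpa using ENat.one_le_iff_ne_zero.mpr this
  · by_contra hc
    push Not at hc
    have hne : (NCGraph s).edist i j ≠ ⊤ := fun h' => by simp [h'] at hc
    obtain ⟨p, hp⟩ := SimpleGraph.exists_walk_of_edist_ne_top hne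
    rw [← hp] at hc
    have hl : p.length < 2 := by exact_mod_cast hc
    match p, hl with
    | .nil, _ => exact h1 rfl
    | .cons ha .nil, _ => exact h2 ha
    | .cons ha (.cons hb q), hl => simp only [SimpleGraph.Walk.length_cons] at hl; omega

lemma dd_eq {n : ℕ} (s : Profile n) (hd : Diam2 s) (i j : Fin n) :
    (NCGraph s).edist i j = (dd s i j : ℕ∞) := by
  refine le_antisymm ?_ (dd_le s i j)
  unfold dd
  split_ifs with h1 h2
  · simp [h1]
  · have := (SimpleGraph.Walk.cons h2 .nil).edist_le
    simpa using this
  · obtain h | ⟨k, ha, hb⟩ := hd i j h1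
    · exact absurd h h2
    · have := (SimpleGraph.Walk.cons ha (.cons hb .nil)).edist_le
      simpa using this

lemma lb_le_cost {n : ℕ} (s : Profile n) (i : Fin n) : (lb s i : ℝ≥0∞) ≤ cost 1 s i := by
  unfold lb cost dCost
  push_cast
  simp only [ENNReal.ofReal_one, one_mul]
  gcongr with j
  have := ENat.toENNReal_le.mpr (dd_le s i j)
  simpa using this

lemma cost_eq {n : ℕ} (s : Profile n) (hd : Diam2 s) (i : Fin n) : cost 1 s i = (lb s i : ℝ≥0∞) := by
  unfold lb cost dCost
  push_cast
  simp only [ENNReal.ofReal_one, one_mul, dd_eq s hd]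
  simp

lemma diam2_mono {n : ℕ} {s t : Profile n} (h : NCGraph s ≤ NCGraph t) (hd : Diam2 s) : Diam2 t := by
  intro i j hij
  obtain ha | ⟨k, ha, hb⟩ := hd i j hij
  · exact Or.inl (h ha)
  · exact Or.inr ⟨k, h ha, h hb⟩

lemma se_in {n : ℕ} {s s' : Profile n} (hs : Valid s) (hse : IsStrongEq 1 s) (hd : Diam2 s)
    (hs' : Valid s') (hd' : Diam2 s') (K : Finset (Fin n)) (hK : K.Nonempty)
    (hag : ∀ i ∉ K, s' i = s i) : ∃ i ∈ K, (InE s' i).card ≤ (InE s i).card := by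
  obtain ⟨i, hi, hc⟩ := hse K s' hK hs' hag
  rw [cost_eq s hd, cost_eq s' hd'] at hc
  have hc' : lb s i ≤ lb s' i := by exact_mod_cast hc
  have := lb_add s hs i
  have := lb_add s' hs' i
  exact ⟨i, hi, by omega⟩

/-- Twice the number of one-sidedly bought edges within `K`. -/
lemma two_mul_sum_le {n : ℕ} (s : Profile n) (K : Finset (Fin n)) :
    2 * ∑ i ∈ K, (InE s i ∩ K).card ≤ ∑ i ∈ K, ∑ j ∈ K, if i = j then 0 else 1 := by
  have h : ∑ i ∈ K, (InE s i ∩ K).card = ∑ i ∈ K, ∑ j ∈ K, if i ∈ s j ∧ j ∉ s i then 1 else 0 := by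
    refine Finset.sum_congr rfl fun i _ => ?_
    rw [← Finset.card_filter]
    congr 1
    ext j; simp [InE]; tauto
  rw [two_mul]
  nth_rewrite 2 [h]
  rw [h]
  nth_rewrite 2 [Finset.sum_comm]
  rw [← Finset.sum_add_distrib]
  refine Finset.sum_le_sum fun i _ => ?_
  simp only [← Finset.sum_add_distrib]
  refine Finset.sum_le_sum fun j _ => ?_
  by_cases hij : i = j
  · subst hij; simp
  · by_cases ha : j ∈ s i <;> by_cases hb : i ∈ s j <;> simp [hij, ha, hb]

lemma sum_ne {n : ℕ} : ∑ i : Fin n, ∑ j : Fin n, (if i = j then 0 else 1) = n * (n - 1) := by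
  have h3 : ∀ i : Fin n, (∑ j : Fin n, if i = j then 0 else 1) = n - 1 := by
    intro i
    have : ∀ j : Fin n, (if i = j then 0 else 1) = if i ≠ j then 1 else 0 := by
      intro j; split_ifs <;> simp_all
    simp only [this]
    rw [← Finset.sum_filter]
    simp [Finset.filter_ne, Finset.card_erase_of_mem]
  simp [h3]

lemma sum_lb {n : ℕ} (s : Profile n) (hs : Valid s) :
    ∑ i, lb s i + ∑ i, (InE s i).card = 2 * (n * (n - 1)) := by
  rw [← Finset.sum_add_distrib]
  simp only [lb_add s hs]
  simp; ring

lemma rational_sum {n : ℕ} (s : Profile n) (hs : Valid s) (hr : Rational s) :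
    2 * ∑ i, (InE s i).card + ∑ i, ∑ j, (if (NCGraph s)ᶜ.Adj i j then 1 else 0) = n * (n - 1) := by
  have h : ∑ i, (InE s i).card = ∑ i, ∑ j, if i ∈ s j then 1 else 0 := by
    refine Finset.sum_congr rfl fun i _ => ?_
    rw [← Finset.card_filter]
    congr 1
    ext j; simp [InE]; exact fun h => hr _ _ h
  rw [two_mul, ← sum_ne]
  nth_rewrite 2 [h]
  rw [h]
  nth_rewrite 2 [Finset.sum_comm]
  simp only [← Finset.sum_add_distrib]
  refine Finset.sum_congr rfl fun i _ => Finset.sum_congr rfl fun j _ => ?_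
  simp only [SimpleGraph.compl_adj, nc_adj]
  have h1 := hr i j
  have h2 := hs i
  by_cases hij : i = j
  · subst hij; simp [h2]
  · by_cases ha : j ∈ s i <;> by_cases hb : i ∈ s j <;> simp_all

lemma even_nn (n : ℕ) : 2 * (3 * n * (n - 1) / 2) = 3 * (n * (n - 1)) := by
  have h := Nat.even_mul_pred_self n
  obtain ⟨k, hk⟩ := h
  rw [mul_assoc, hk]; omega

lemma social_ge {n : ℕ} (s : Profile n) (hs : Valid s) :
    ((3 * n * (n - 1) / 2 : ℕ) : ℝ≥0∞) ≤ socialCost 1 s := by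
  have h1 : ((∑ i, lb s i : ℕ) : ℝ≥0∞) ≤ socialCost 1 s := by
    unfold socialCost; push_cast
    exact Finset.sum_le_sum fun i _ => lb_le_cost s i
  refine le_trans ?_ h1
  have h2 := sum_lb s hs
  have h3 := two_mul_sum_le s univ
  rw [sum_ne] at h3
  simp only [Finset.inter_univ] at h3
  have h4 := even_nn n
  norm_cast
  omega

lemma social_eq {n : ℕ} (s : Profile n) (hd : Diam2 s) :
    socialCost 1 s = ((∑ i, lb s i : ℕ) : ℝ≥0∞) := by
  unfold socialCost; push_cast
  exact Finset.sum_congr rfl fun i _ => cost_eq s hd i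

lemma se_diam {n : ℕ} (s : Profile n) (hs : Valid s) (hse : IsStrongEq 1 s) : Diam2 s := by
  intro i j hij
  by_contra hno
  have h3 : 3 ≤ (NCGraph s).edist i j := by
    by_contra h
    push Not at h
    obtain h | h := edist_lt_three _ _ _ h
    · exact hij h
    · exact hno h
  have hfin : cost 1 s i ≠ ⊤ := by
    obtain ⟨k, hk, hc⟩ := hse {i} (Function.update s i (univ.erase i)) (by simp)
      (by
        intro k
        by_cases hk : k = i
        · subst hk; simp
        · simp [Function.update_of_ne hk, hs k])
      (by
        intro k hk
        rw [Function.update_of_ne (by simpa using hk)])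
    simp only [Finset.mem_singleton] at hk
    subst hk
    rw [cost_eq (Function.update s k (univ.erase k))] at hc
    · exact ne_top_of_le_ne_top (ENNReal.natCast_ne_top _) hc
    · intro a b hab
      have hadj : ∀ c, c ≠ k → (NCGraph (Function.update s k (univ.erase k))).Adj k c := by
        intro c hc
        rw [nc_adj]
        exact ⟨hc.symm, by simp [hc]⟩
      by_cases ha : a = k
      · subst ha; exact Or.inl (hadj b hab.symm)
      · by_cases hb : b = k
        · subst hb; exact Or.inl (hadj a hab).symm
        · exact Or.inr ⟨k, (hadj a ha).symm, hadj b hb⟩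
  have hji : j ∉ s i := fun h => hno (Or.inl ((nc_adj s i j).mpr ⟨hij, Or.inl h⟩))
  have hle : NCGraph s ≤ NCGraph (Function.update s i (insert j (s i))) := by
    intro a b hab
    rw [nc_adj] at hab ⊢
    refine ⟨hab.1, ?_⟩
    have key : ∀ c d, d ∈ s c → d ∈ Function.update s i (insert j (s i)) c := by
      intro c d h
      by_cases hc : c = i
      · subst hc; simp [h]
      · simpa [Function.update_of_ne hc] using h
    exact hab.2.imp (key _ _) (key _ _)
  obtain ⟨k, hk, hc⟩ := hse {i} (Function.update s i (insert j (s i))) (by simp)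
    (by
      intro k
      by_cases hk : k = i
      · subst hk; simp [hs k, hij]
      · simp [Function.update_of_ne hk, hs k])
    (by
      intro k hk
      rw [Function.update_of_ne (by simpa using hk)])
  simp only [Finset.mem_singleton] at hk
  subst hk
  have hd : dCost (Function.update s k (insert j (s k))) k + 2 ≤ dCost s k := by
    have h2 : (2 : ℝ≥0∞) = ∑ b : Fin n, if b = j then 2 else 0 := by simp
    unfold dCost
    rw [h2, ← Finset.sum_add_distrib]
    refine Finset.sum_le_sum fun b _ => ?_
    split_ifs with hb
    · subst hb
      have h1 : (NCGraph (Function.update s k (insert b (s k)))).edist k b ≤ 1 := by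
        have hadj : (NCGraph (Function.update s k (insert b (s k)))).Adj k b := by
          rw [nc_adj]; exact ⟨hij, by simp⟩
        simpa using (SimpleGraph.Walk.cons hadj .nil).edist_le
      have h1' := ENat.toENNReal_le.mpr h1
      have h3' := ENat.toENNReal_le.mpr h3
      simp only [ENat.toENNReal_one] at h1'
      calc _ ≤ (1 : ℝ≥0∞) + 2 := by gcongr
        _ = ((3 : ℕ∞) : ℝ≥0∞) := by norm_num
        _ ≤ _ := h3'
    · rw [add_zero]
      exact ENat.toENNReal_le.mpr (SimpleGraph.edist_anti hle)
  have hlt : cost 1 s k < cost 1 s k := by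
    have hc2 : cost 1 (Function.update s k (insert j (s k))) k + 1 ≤ cost 1 s k := by
      unfold cost
      simp only [Function.update_self, Finset.card_insert_of_notMem hji, ENNReal.ofReal_one, one_mul]
      calc _ = ((s k).card : ℝ≥0∞) + (dCost (Function.update s k (insert j (s k))) k + 2) := by
            push_cast; ring
        _ ≤ _ := by gcongr
    calc cost 1 s k < cost 1 s k + 1 := ENNReal.lt_add_right hfin one_ne_zero
      _ ≤ _ := by gcongr
      _ ≤ _ := hc2
  exact lt_irrefl _ hlt

lemma se_rational {n : ℕ} (s : Profile n) (hs : Valid s) (hse : IsStrongEq 1 s) : Rational s := by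
  intro i j hj hi
  have hd := se_diam s hs hse
  have hij : i ≠ j := fun h => hs i (h ▸ hj)
  set s' := Function.update s i ((s i).erase j) with hs'def
  have hsi : s' i = (s i).erase j := by simp [hs'def]
  have hso : ∀ k, k ≠ i → s' k = s k := fun k hk => by simp [hs'def, Function.update_of_ne hk]
  have hv : Valid s' := by
    intro k
    by_cases hk : k = i
    · subst hk; rw [hsi]; simp [hs k]
    · rw [hso k hk]; exact hs k
  have hle : NCGraph s ≤ NCGraph s' := by
    have key : ∀ a b, b ∈ s a → b ∈ s' a ∨ a ∈ s' b := by
      intro a b h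
      by_cases ha : a = i
      · subst ha
        by_cases hb : b = j
        · subst hb; right; rw [hso b hij.symm]; exact hi
        · left; rw [hsi]; simp [hb, h]
      · left; rw [hso a ha]; exact h
    intro a b hab
    rw [nc_adj] at hab ⊢
    exact ⟨hab.1, hab.2.elim (key a b) (fun h => (key b a h).symm)⟩
  obtain ⟨k, hk, hc⟩ := se_in hs hse hd hv (diam2_mono hle hd) {i} (by simp)
    (fun k hk => hso k (by simpa using hk))
  simp only [Finset.mem_singleton] at hk
  subst hk
  have : InE s k ⊂ InE s' k := by
    rw [Finset.ssubset_iff_of_subset]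
    · refine ⟨j, ?_, ?_⟩
      · simp [InE, hsi, hso j hij.symm, hi]
      · simp [InE, hj]
    · intro b hb
      simp only [InE, Finset.mem_filter, Finset.mem_univ, true_and] at hb ⊢
      have hbk : b ≠ k := by rintro rfl; exact hs _ hb.1
      rw [hso b hbk, hsi]
      exact ⟨hb.1, fun h => hb.2 (Finset.mem_of_mem_erase h)⟩
  have := Finset.card_lt_card this
  omega

/-- No functional cycle in the complement. -/
lemma se_nofun {n : ℕ} (s : Profile n) (hs : Valid s) (hse : IsStrongEq 1 s)
    (K : Finset (Fin n)) (hK : K.Nonempty) (f : Fin n → Fin n) (hf : ∀ i ∈ K, f i ∈ K)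
    (hadj : ∀ i ∈ K, (NCGraph s)ᶜ.Adj i (f i)) (hff : ∀ i ∈ K, f (f i) ≠ i) : False := by
  have hd := se_diam s hs hse
  let s' : Profile n := fun i => s i ∪ K.filter (fun j => f j = i)
  have hm : ∀ a b, b ∈ s' a ↔ b ∈ s a ∨ (b ∈ K ∧ f b = a) := by
    intro a b; simp [s']
  have hv : Valid s' := by
    intro i hi
    rw [hm] at hi
    obtain h | ⟨h, h'⟩ := hi
    · exact hs i h
    · have := (hadj i h).ne; exact this h'.symm
  have hle : NCGraph s ≤ NCGraph s' := by
    intro a b hab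
    rw [nc_adj] at hab ⊢
    simp only [hm]
    tauto
  obtain ⟨i, hi, hc⟩ := se_in hs hse hd hv (diam2_mono hle hd) K hK (by
    intro k hk
    ext b
    rw [hm]
    constructor
    · rintro (h | ⟨h, h'⟩)
      · exact h
      · exact absurd (h' ▸ hf b h) hk
    · exact Or.inl)
  have hna : ∀ a ∈ K, a ∉ s (f a) ∧ f a ∉ s a := by
    intro a ha
    have := hadj a ha
    rw [SimpleGraph.compl_adj, nc_adj] at this
    tauto
  have : InE s i ⊂ InE s' i := by
    rw [Finset.ssubset_iff_of_subset]
    · refine ⟨f i, ?_, ?_⟩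
      · simp only [InE, Finset.mem_filter, Finset.mem_univ, true_and, hm]
        exact ⟨Or.inr ⟨hi, trivial⟩, by
          rintro (h | ⟨h, h'⟩)
          · exact (hna i hi).2 h
          · exact hff i hi h'⟩
      · simp only [InE, Finset.mem_filter, Finset.mem_univ, true_and]
        exact fun h => (hna i hi).1 h.1
    · intro b hb
      simp only [InE, Finset.mem_filter, Finset.mem_univ, true_and, hm] at hb ⊢
      refine ⟨Or.inl hb.1, ?_⟩
      rintro (h | ⟨h, h'⟩)
      · exact hb.2 h
      · subst h'; exact (hna b h).2 hb.1
  have := Finset.card_lt_card this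
  omega

lemma se_acyclic {n : ℕ} (s : Profile n) (hs : Valid s) (hse : IsStrongEq 1 s) :
    (NCGraph s)ᶜ.IsAcyclic := by
  intro v c hc
  have hinj := hc.getVert_injOn
  have hl := hc.three_le_length
  have hidx : ∀ x, ∃ k, x ∈ c.support.toFinset → 1 ≤ k ∧ k ≤ c.length ∧ c.getVert k = x := by
    intro x
    by_cases hx : x ∈ c.support
    · obtain ⟨k, hk, hkl⟩ := SimpleGraph.Walk.mem_support_iff_exists_getVert.mp hx
      by_cases h0 : k = 0
      · refine ⟨c.length, fun _ => ⟨by omega, le_rfl, ?_⟩⟩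
        subst h0; rw [← hk]; simp
      · exact ⟨k, fun _ => ⟨by omega, hkl, hk⟩⟩
    · exact ⟨0, fun h => absurd (by simpa using h) hx⟩
  choose idx hix using hidx
  have hmem : ∀ k, c.getVert k ∈ c.support.toFinset := by
    intro k; simp
  refine se_nofun s hs hse c.support.toFinset ⟨v, by simp⟩ (fun x => c.getVert (idx x - 1))
    (fun x _ => hmem _) ?_ ?_
  · intro x hx
    obtain ⟨h1, h2, h3⟩ := hix x hx
    have := c.adj_getVert_succ (i := idx x - 1) (by omega)
    rw [Nat.sub_add_cancel h1, h3] at this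
    exact this.symm
  · intro x hx heq
    obtain ⟨h1, h2, h3⟩ := hix x hx
    obtain ⟨g1, g2, g3⟩ := hix _ (hmem (idx x - 1))
    set m := idx (c.getVert (idx x - 1))
    have hI : ∀ a b, 1 ≤ a → a ≤ c.length → 1 ≤ b → b ≤ c.length →
        c.getVert a = c.getVert b → a = b := fun a b a1 a2 b1 b2 h => hinj ⟨a1, a2⟩ ⟨b1, b2⟩ h
    have h0 : c.getVert 0 = c.getVert c.length := by simp
    by_cases hk : idx x = 1
    · have hm : m = c.length := by
        apply hI m c.length g1 g2 (by omega) le_rfl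
        rw [g3, hk]; simpa using h0
      have := hI (m - 1) (idx x) (by omega) (by omega) h1 h2 (heq.trans h3.symm)
      omega
    · have hm : m = idx x - 1 := hI _ _ g1 g2 (by omega) (by omega) g3
      by_cases hk2 : idx x = 2
      · have h5 : c.getVert c.length = c.getVert (idx x) := by
          rw [← h0, h3, ← heq]; congr 1; omega
        have := hI _ _ (by omega) le_rfl h1 h2 h5
        omega
      · have := hI (m - 1) (idx x) (by omega) (by omega) h1 h2 (heq.trans h3.symm)
        omega

lemma se_upper {n : ℕ} (hn : 5 ≤ n) (s : Profile n) (hs : Valid s) (hse : IsStrongEq 1 s) :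
    socialCost 1 s ≤ ((3 * n * (n - 1) / 2 + (n - 1) : ℕ) : ℝ≥0∞) := by
  rw [social_eq s (se_diam s hs hse)]
  have h1 := sum_lb s hs
  have h2 := rational_sum s hs (se_rational s hs hse)
  have h3 : ∑ i, ∑ j, (if (NCGraph s)ᶜ.Adj i j then 1 else 0) ≤ 2 * (n - 1) := by
    have h4 := (NCGraph s)ᶜ.sum_degrees_eq_twice_card_edges
    have h5 : ∀ i, (∑ j, (if (NCGraph s)ᶜ.Adj i j then 1 else 0)) = (NCGraph s)ᶜ.degree i := by
      intro i
      rw [← SimpleGraph.card_neighborFinset_eq_degree, ← Finset.card_filter,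
        SimpleGraph.neighborFinset_eq_filter]
    simp only [h5]
    rw [h4]
    have : (NCGraph s)ᶜ.edgeFinset.card ≤ n - 1 := by
      have : Nonempty (Fin n) := ⟨⟨0, by omega⟩⟩
      obtain ⟨T, hle, -, hT⟩ :=
        (SimpleGraph.connected_top (V := Fin n)).exists_isTree_le_of_le_of_isAcyclic
          (le_top : (NCGraph s)ᶜ ≤ ⊤) (se_acyclic s hs hse)
      classical
      have h6 := hT.card_edgeFinset
      have h7 := Finset.card_le_card (SimpleGraph.edgeFinset_mono hle)
      rw [Fintype.card_fin] at h6
      omega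
    omega
  have h4 := even_nn n
  norm_cast
  omega

/-- The extremal profile: complement of a path. -/
def pathP (n : ℕ) : Profile n := fun i => univ.filter (fun j => i.val + 1 < j.val)

lemma pathP_mem {n : ℕ} (i j : Fin n) : j ∈ pathP n i ↔ i.val + 1 < j.val := by simp [pathP]

lemma pathP_valid (n : ℕ) : Valid (pathP n) := by
  intro i; rw [pathP_mem]; omega

lemma pathP_rational (n : ℕ) : Rational (pathP n) := by
  intro i j; rw [pathP_mem, pathP_mem]; omega

lemma pathP_diam {n : ℕ} (hn : 5 ≤ n) : Diam2 (pathP n) := by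
  intro i j hij
  simp only [nc_adj, pathP_mem, ne_eq, Fin.ext_iff] at hij ⊢
  by_cases h : i.val + 1 < j.val ∨ j.val + 1 < i.val
  · exact Or.inl ⟨hij, h⟩
  · right
    have hi := i.2
    have hj := j.2
    by_cases h2 : 2 ≤ i.val ∧ 2 ≤ j.val
    · exact ⟨⟨0, by omega⟩, by simp only; omega, by simp only; omega⟩
    · exact ⟨⟨4, by omega⟩, by simp only; omega, by simp only; omega⟩

lemma pathP_se {n : ℕ} (hn : 5 ≤ n) : IsStrongEq 1 (pathP n) := by
  intro K s' hK hv hag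
  by_contra hno
  push Not at hno
  have hlt : ∀ i ∈ K, (InE (pathP n) i).card + 1 ≤ (InE s' i).card := by
    intro i hi
    have h := hno i hi
    rw [cost_eq _ (pathP_diam hn)] at h
    have h' := lt_of_le_of_lt (lb_le_cost s' i) h
    have h'' : lb s' i < lb (pathP n) i := by exact_mod_cast h'
    have := lb_add s' hv i
    have := lb_add _ (pathP_valid n) i
    omega
  have hlt2 : ∀ i ∈ K, (InE (pathP n) i ∩ K).card + 1 ≤ (InE s' i ∩ K).card := by
    intro i hi
    have h := hlt i hi
    have h1 := Finset.card_inter_add_card_sdiff (InE s' i) K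
    have h2 := Finset.card_inter_add_card_sdiff (InE (pathP n) i) K
    have h3 : InE s' i \ K ⊆ InE (pathP n) i \ K := by
      intro j hj
      simp only [Finset.mem_sdiff, InE, Finset.mem_filter, Finset.mem_univ, true_and] at hj ⊢
      rw [hag j hj.2] at hj
      exact ⟨⟨hj.1.1, pathP_rational n _ _ hj.1.1⟩, hj.2⟩
    have := Finset.card_le_card h3
    omega
  have hsum := Finset.sum_le_sum hlt2
  rw [Finset.sum_add_distrib] at hsum
  simp only [Finset.sum_const, smul_eq_mul, mul_one] at hsum
  have h2 := two_mul_sum_le s' K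
  have h4 : ∑ i ∈ K, ∑ j ∈ K, (if i = j then 0 else 1) =
      2 * ∑ i ∈ K, (K.filter (fun j => j < i)).card := by
    simp only [Finset.card_filter]
    rw [two_mul]
    nth_rewrite 2 [Finset.sum_comm]
    simp only [← Finset.sum_add_distrib]
    refine Finset.sum_congr rfl fun i _ => Finset.sum_congr rfl fun j _ => ?_
    rcases lt_trichotomy i j with h | h | h
    · simp [h, h.ne, h.le]
    · simp [h]
    · simp [h, h.ne', h.le]
  have h5 : ∀ i ∈ K, (K.filter (fun j => j < i)).card ≤
      (InE (pathP n) i ∩ K).card + if i = K.min' hK then 0 else 1 := by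
    intro i hi
    split_ifs with him
    · have : K.filter (fun j => j < i) = ∅ := by
        rw [Finset.filter_eq_empty_iff]
        intro j hj
        rw [him]
        exact not_lt.mpr (K.min'_le j hj)
      simp [this]
    · have hi0 : K.min' hK < i := lt_of_le_of_ne (K.min'_le i hi) (Ne.symm him)
      have hi1 : 0 < i.val := by
        have : (K.min' hK).val < i.val := hi0
        omega
      have : K.filter (fun j => j < i) ⊆
          insert (⟨i.val - 1, by omega⟩ : Fin n) (InE (pathP n) i ∩ K) := by
        intro j hj
        simp only [Finset.mem_filter, Finset.mem_insert, Finset.mem_inter, InE, Finset.mem_univ,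
          true_and, pathP_mem, Fin.ext_iff, Fin.lt_def] at hj ⊢
        by_cases h : j.val = i.val - 1
        · exact Or.inl h
        · exact Or.inr ⟨⟨by omega, by omega⟩, hj.1⟩
      exact (Finset.card_le_card this).trans (Finset.card_insert_le _ _)
  have h6 := Finset.sum_le_sum h5
  rw [Finset.sum_add_distrib] at h6
  have h7 : (∑ i ∈ K, if i = K.min' hK then 0 else 1) + 1 = K.card := by
    have h8 : ∀ j : Fin n, (if j = K.min' hK then 0 else 1) = if j ≠ K.min' hK then 1 else 0 := by
      intro j; split_ifs <;> simp_all
    simp only [h8]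
    rw [← Finset.sum_filter, Finset.sum_const, smul_eq_mul, mul_one, Finset.filter_ne',
      Finset.card_erase_of_mem (K.min'_mem hK)]
    have := hK.card_pos
    omega
  omega

lemma pathP_cost {n : ℕ} (hn : 5 ≤ n) :
    socialCost 1 (pathP n) = ((3 * n * (n - 1) / 2 + (n - 1) : ℕ) : ℝ≥0∞) := by
  rw [social_eq _ (pathP_diam hn)]
  have h1 := sum_lb _ (pathP_valid n)
  have h2 := rational_sum _ (pathP_valid n) (pathP_rational n)
  have h3 : ∑ i, ∑ j, (if (NCGraph (pathP n))ᶜ.Adj i j then 1 else 0) = 2 * (n - 1) := by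
    have h : ∀ i j, (if (NCGraph (pathP n))ᶜ.Adj i j then 1 else 0) =
        (if i.val + 1 = j.val then 1 else 0) + (if j.val + 1 = i.val then 1 else 0) := by
      intro i j
      simp only [SimpleGraph.compl_adj, nc_adj, pathP_mem, ne_eq, Fin.ext_iff]
      split_ifs <;> omega
    simp only [h, Finset.sum_add_distrib]
    nth_rewrite 2 [Finset.sum_comm]
    rw [← two_mul]
    congr 1
    obtain ⟨m, rfl⟩ : ∃ m, n = m + 1 := ⟨n - 1, by omega⟩
    rw [Finset.sum_comm, Fin.sum_univ_succ]
    have ha : ∀ j : Fin m, (∑ i : Fin (m + 1), if i.val + 1 = (Fin.succ j).val then 1 else 0) = 1 := by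
      intro j
      rw [Finset.sum_eq_single (Fin.castSucc j)]
      · simp
      · intro b _ hb
        rw [if_neg]
        intro h; apply hb; ext; simp at h ⊢; exact h
      · simp
    simp only [ha]
    simp
  have h4 := even_nn n
  congr 1
  omega

/-- The complete graph. -/
def compP (n : ℕ) : Profile n := fun i => univ.filter (fun j => i.val < j.val)

lemma compP_cost {n : ℕ} : socialCost 1 (compP n) = ((3 * n * (n - 1) / 2 : ℕ) : ℝ≥0∞) := by
  have hm : ∀ i j, j ∈ compP n i ↔ i.val < j.val := by intro i j; simp [compP]
  have hv : Valid (compP n) := by intro i; rw [hm]; omega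
  have hr : Rational (compP n) := by intro i j; rw [hm, hm]; omega
  have hadj : ∀ i j, i ≠ j → (NCGraph (compP n)).Adj i j := by
    intro i j hij
    rw [nc_adj, hm, hm]
    refine ⟨hij, ?_⟩
    rw [ne_eq, Fin.ext_iff] at hij
    omega
  rw [social_eq _ (fun i j hij => Or.inl (hadj i j hij))]
  have h1 := sum_lb _ hv
  have h2 := rational_sum _ hv hr
  have h3 : ∑ i, ∑ j, (if (NCGraph (compP n))ᶜ.Adj i j then 1 else 0) = 0 := by
    refine Finset.sum_eq_zero fun i _ => Finset.sum_eq_zero fun j _ => ?_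
    rw [if_neg]
    rw [SimpleGraph.compl_adj]
    exact fun h => h.2 (hadj i j h.1)
  have h4 := even_nn n
  congr 1
  omega

/-- For `α = 1` and `n ≥ 5`: the worst strong equilibrium has social cost
`3n(n−1)/2 + (n−1)`, the optimum is `3n(n−1)/2`, and their ratio is `(3n+2)/(3n)`. -/
theorem stmt13 {n : ℕ} (hn : 5 ≤ n) :
    (∀ s : Profile n, Valid s → IsStrongEq 1 s →
        socialCost 1 s ≤ ((3 * n * (n - 1) / 2 + (n - 1) : ℕ) : ℝ≥0∞)) ∧
    (∃ s : Profile n, Valid s ∧ IsStrongEq 1 s ∧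
        socialCost 1 s = ((3 * n * (n - 1) / 2 + (n - 1) : ℕ) : ℝ≥0∞)) ∧
    (∀ t : Profile n, Valid t → ((3 * n * (n - 1) / 2 : ℕ) : ℝ≥0∞) ≤ socialCost 1 t) ∧
    (∃ t : Profile n, Valid t ∧ socialCost 1 t = ((3 * n * (n - 1) / 2 : ℕ) : ℝ≥0∞)) ∧
    ((3 * n * (n - 1) / 2 + (n - 1) : ℕ) : ℝ) / ((3 * n * (n - 1) / 2 : ℕ) : ℝ) =
      (3 * n + 2 : ℝ) / (3 * n : ℝ) := by
  refine ⟨fun s hs hse => se_upper hn s hs hse,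
    ⟨pathP n, pathP_valid n, pathP_se hn, pathP_cost hn⟩,
    fun t ht => social_ge t ht,
    ⟨compP n, fun i => by simp [compP], compP_cost⟩, ?_⟩
  have h := even_nn n
  have h' : (2 : ℝ) * ((3 * n * (n - 1) / 2 : ℕ) : ℝ) = 3 * (n * ((n : ℝ) - 1)) := by
    have := congrArg (Nat.cast : ℕ → ℝ) h
    push_cast [Nat.cast_sub (show 1 ≤ n by omega)] at this ⊢
    exact this
  have hn' : (5 : ℝ) ≤ n := by exact_mod_cast hn
  rw [Nat.cast_add, Nat.cast_sub (show 1 ≤ n by omega)]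
  generalize ((3 * n * (n - 1) / 2 : ℕ) : ℝ) = x at h' ⊢
  have hx : x = 3 * (n * ((n : ℝ) - 1)) / 2 := by linarith
  have h1 : (n : ℝ) - 1 ≠ 0 := by linarith
  have h0 : (n : ℝ) ≠ 0 := by linarith
  rw [hx]
  push_cast
  field_simp
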